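/- arXiv:2207.04450 — 7 statements merged into one kernel-verified Lean document; each statement's English description precedes it below -/
import Mathlib

section
/- Let f : A → B be a ring homomorphism of commutative rings with B noetherian, let 𝔞 be an ideal of A and let b̃ ⊆ 𝔟 be ideals of B with f(𝔞) ⊆ b̃. Then B is formally smooth over (A, 𝔞-adic topology) for the ideal 𝔟 with the b̃-adic topology if and only if B is formally smooth over (A, 𝔞-adic topology) for the ideal 𝔟 with the 𝔟-adic topology. -/
universe u v

/-- `B` is *formally smooth* over `(A, 𝔄)` for the ideal `b` with the `𝔅`-topology, where
`𝔄 = (𝔄 n)` and `𝔅 = (𝔅 n)` are filtrations by ideals (indexed so that `𝔄 n`, `𝔅 n`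
correspond to the `(n+1)`-st terms `𝔞_{n+1}`, `𝔟_{n+1}`): for every `A`-algebra `C` killed
by some `𝔄 r`, every square-zero ideal `M` of `C`, and every `A`-algebra map `u : B → C/M`
killing some `𝔅 t` and such that the preimage in `C` of the ideal generated by `u(b)`
kills `M`, there is an `A`-algebra lift `g : B → C` of `u`. -/
def IsFormallySmoothFor (A : Type u) (B : Type v) [CommRing A] [CommRing B] [Algebra A B]
    (𝔄 : ℕ → Ideal A) (b : Ideal B) (𝔅 : ℕ → Ideal B) : Prop :=
  ∀ (C : Type (max u v)) [CommRing C] [Algebra A C],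
    (∃ r, Ideal.map (algebraMap A C) (𝔄 r) = ⊥) →
    ∀ (M : Ideal C), M ^ 2 = ⊥ →
      ∀ u : B →ₐ[A] C ⧸ M,
        (∃ t, Ideal.map u (𝔅 t) = ⊥) →
        (Ideal.comap (Ideal.Quotient.mk M) (Ideal.map u b)) * M = ⊥ →
        ∃ g : B →ₐ[A] C, (Ideal.Quotient.mkₐ A M).comp g = u

/-- A finitely generated ideal annihilating `M`, with `E ⧸ M` noetherian, has a power which
meets `M` trivially: it is a finite module over `E ⧸ M`, to which Artin–Rees applies. -/
theorem Ideal.exists_pow_inf_eq_bot_of_mul_eq_bot {E : Type*} [CommRing E] (M I : Ideal E)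
    [IsNoetherianRing (E ⧸ M)] (hI : I.FG) (hIM : I * M = ⊥) :
    ∃ n, I ^ (n + 2) ⊓ M = ⊥ := by
  have hmul : ∀ a ∈ I, ∀ m ∈ M, a * m = 0 := fun a ha m hm ↦ by
    have : a * m ∈ I * M := Ideal.mul_mem_mul ha hm
    rwa [hIM, Ideal.mem_bot] at this
  have htor : Module.IsTorsionBySet E I M := by
    rintro ⟨x, hx⟩ ⟨m, hm⟩
    exact Subtype.ext (by simpa [mul_comm] using hmul x hx m hm)
  let : Module (E ⧸ M) I := htor.module
  have hsmul : ∀ (a : E) (v : I), Ideal.Quotient.mk M a • v = a • v := fun a v ↦ rfl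
  have : IsScalarTower E (E ⧸ M) I := htor.isScalarTower
  have : Module.Finite E I := Module.Finite.iff_fg.mpr hI
  have : Module.Finite (E ⧸ M) I := Module.Finite.of_restrictScalars_finite E _ _
  let N : Submodule (E ⧸ M) I :=
    { carrier := {v | (v : E) ∈ M}
      add_mem' := fun ha hb ↦ M.add_mem ha hb
      zero_mem' := M.zero_mem
      smul_mem' := fun c v hv ↦ by
        obtain ⟨a, rfl⟩ := Ideal.Quotient.mk_surjective c
        rw [hsmul]
        exact M.mul_mem_left a hv }
  let I' : Ideal (E ⧸ M) := I.map (Ideal.Quotient.mk M)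
  obtain ⟨k, hk⟩ := Ideal.exists_pow_inf_eq_pow_smul I' N
  have hI'N : I' • N = ⊥ := by
    rw [eq_bot_iff, Submodule.smul_le]
    intro r hr v hv
    obtain ⟨a, ha, rfl⟩ :=
      (Ideal.mem_map_iff_of_surjective _ Ideal.Quotient.mk_surjective).mp hr
    rw [Submodule.mem_bot, hsmul]
    exact Subtype.ext (hmul a ha v hv)
  refine ⟨k, eq_bot_iff.mpr ?_⟩
  rintro z ⟨hz, hzM⟩
  have hz' : ∃ v : I, (v : E) = z ∧ v ∈ I' ^ (k + 1) • (⊤ : Submodule (E ⧸ M) I) := by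
    have hz₀ : z ∈ I ^ (k + 1) * I := by rw [← pow_succ]; exact hz
    refine Submodule.mul_induction_on hz₀ (fun a ha b hb ↦ ⟨a • ⟨b, hb⟩, rfl, ?_⟩) ?_
    · rw [← hsmul]
      refine Submodule.smul_mem_smul ?_ trivial
      rw [← Ideal.map_pow]
      exact Ideal.mem_map_of_mem _ ha
    · rintro _ _ ⟨v, rfl, hv⟩ ⟨w, rfl, hw⟩
      exact ⟨v + w, rfl, add_mem hv hw⟩
  obtain ⟨v, rfl, hv⟩ := hz'
  have hvN : v ∈ I' ^ (k + 1) • (⊤ : Submodule (E ⧸ M) I) ⊓ N := ⟨hv, hzM⟩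
  rw [hk (k + 1) (by omega), Nat.add_sub_cancel_left, pow_one] at hvN
  have := Submodule.smul_mono le_rfl inf_le_right hvN
  rw [hI'N, Submodule.mem_bot] at this
  simp [this]

/-- For a surjection `π : E → B` onto a noetherian ring whose kernel is
annihilated by the preimage of `b`, some ideal `J` of `E` meets `ker π` trivially, generates
a power of `b`, and contains the same power of the preimage of `b`. -/
theorem Ideal.exists_inf_ker_eq_bot_of_surjective {E B : Type*} [CommRing E] [CommRing B]
    [IsNoetherianRing B] (π : E →+* B) (hπ : Function.Surjective π) (b : Ideal B)
    (hb : b.comap π * RingHom.ker π = ⊥) :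
    ∃ (J : Ideal E) (n : ℕ), J ⊓ RingHom.ker π = ⊥ ∧ J.map π = b ^ (n + 1) ∧
      b.comap π ^ (n + 1) ≤ J := by
  obtain ⟨I, hI, rfl⟩ : ∃ I : Ideal E, I.FG ∧ I.map π = b := by
    obtain ⟨s, rfl⟩ := IsNoetherian.noetherian b
    classical
    refine ⟨Ideal.span (s.image (Function.surjInv hπ)), ⟨_, rfl⟩, ?_⟩
    rw [Ideal.map_span, Finset.coe_image, Set.image_image]
    simp [Function.surjInv_eq hπ]
  have hcomap : (I.map π).comap π = I ⊔ RingHom.ker π := Ideal.comap_map_of_surjective π hπ I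
  rw [hcomap] at hb ⊢
  rw [Ideal.sup_mul, sup_eq_bot_iff] at hb
  have : IsNoetherianRing (E ⧸ RingHom.ker π) :=
    isNoetherianRing_of_ringEquiv B (RingHom.quotientKerEquivOfSurjective hπ).symm
  obtain ⟨n, hn⟩ := Ideal.exists_pow_inf_eq_bot_of_mul_eq_bot (RingHom.ker π) I hI hb.1
  refine ⟨I ^ (n + 2), n + 1, hn, Ideal.map_pow π I _, ?_⟩
  have hpow : ∀ k : ℕ, (I ⊔ RingHom.ker π) ^ (k + 2) = I ^ (k + 2) := by
    intro k
    induction k with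
    | zero =>
      rw [zero_add, pow_two, pow_two, Ideal.sup_mul, Ideal.mul_sup, Ideal.mul_sup,
        mul_comm (RingHom.ker π) I, hb.1, hb.2]
      simp
    | succ k ih =>
      rw [pow_succ, ih, Ideal.mul_sup, ← pow_succ, pow_succ I (k + 1), mul_assoc, hb.1]
      simp
  exact (hpow n).le

/-- An algebra surjection `π : E → B` has a section as soon as, for some ideal `J` meeting
`ker π` trivially, the induced map from `B` to the quotient of `E ⧸ J` by the image of `ker π`
lifts to `E ⧸ J`. -/
theorem AlgHom.exists_section_of_quotient_lift {A E B : Type*} [CommRing A] [CommRing E]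
    [CommRing B] [Algebra A E] [Algebra A B] (π : E →ₐ[A] B) (hπ : Function.Surjective π)
    (J : Ideal E) (hJ : J ⊓ RingHom.ker π = ⊥) (g : B →ₐ[A] E ⧸ J)
    (hg : ∀ e, g (π e) - Ideal.Quotient.mk J e ∈
      (RingHom.ker π).map (Ideal.Quotient.mk J)) :
    ∃ s : B →ₐ[A] E, π.comp s = AlgHom.id A B := by
  let ι : E →ₐ[A] B × (E ⧸ J) := π.prod (Ideal.Quotient.mkₐ A J)
  have hι : Function.Injective ι := by
    rw [injective_iff_map_eq_zero]
    intro e he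
    have h1 : π e = 0 := congrArg Prod.fst he
    have h2 : Ideal.Quotient.mk J e = 0 := congrArg Prod.snd he
    have : e ∈ J ⊓ RingHom.ker π := ⟨Ideal.Quotient.eq_zero_iff_mem.mp h2, h1⟩
    rwa [hJ, Ideal.mem_bot] at this
  have hmem : ∀ y, (AlgHom.id A B).prod g y ∈ ι.range := by
    intro y
    obtain ⟨e, rfl⟩ := hπ y
    obtain ⟨m, hm, hme⟩ :=
      (Ideal.mem_map_iff_of_surjective _ Ideal.Quotient.mk_surjective).mp (hg e)
    refine ⟨e + m, Prod.ext ?_ ?_⟩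
    · change π (e + m) = π e
      rw [map_add, (show π m = 0 from hm), add_zero]
    · change Ideal.Quotient.mk J (e + m) = g (π e)
      rw [map_add, hme]
      ring
  refine ⟨(AlgEquiv.ofInjective ι hι).symm.toAlgHom.comp
    (AlgHom.codRestrict ((AlgHom.id A B).prod g) ι.range hmem), ?_⟩
  ext y
  have h := congrArg Subtype.val ((AlgEquiv.ofInjective ι hι).apply_symm_apply
    (AlgHom.codRestrict ((AlgHom.id A B).prod g) ι.range hmem y))
  exact congrArg Prod.fst h

/-- For noetherian `B`, formal smoothness for `b` with the `b`-adic topology yields sections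
of all square-zero extensions of `B` whose kernel is annihilated by the preimage of `b`. -/
theorem IsFormallySmoothFor.exists_section {A : Type u} {B : Type v} [CommRing A] [CommRing B]
    [Algebra A B] [IsNoetherianRing B] {𝔞 : Ideal A} {b : Ideal B}
    (hab : 𝔞.map (algebraMap A B) ≤ b)
    (h : IsFormallySmoothFor A B (fun n => 𝔞 ^ (n + 1)) b (fun n => b ^ (n + 1)))
    {E : Type (max u v)} [CommRing E] [Algebra A E] (π : E →ₐ[A] B)
    (hπ : Function.Surjective π) (hker : RingHom.ker π ^ 2 = ⊥)
    (hb : b.comap π * RingHom.ker π = ⊥) :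
    ∃ s : B →ₐ[A] E, π.comp s = AlgHom.id A B := by
  obtain ⟨J, n, hJ, hJb, hbJ⟩ :=
    Ideal.exists_inf_ker_eq_bot_of_surjective (π : E →+* B) hπ b hb
  let M' : Ideal (E ⧸ J) := (RingHom.ker π).map (Ideal.Quotient.mk J)
  let q : E →ₐ[A] (E ⧸ J) ⧸ M' := (Ideal.Quotient.mkₐ A M').comp (Ideal.Quotient.mkₐ A J)
  have hq : ∀ e ∈ RingHom.ker π, q e = 0 := fun e he ↦
    Ideal.Quotient.eq_zero_iff_mem.mpr (Ideal.mem_map_of_mem _ he)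
  let u : B →ₐ[A] (E ⧸ J) ⧸ M' := (Ideal.Quotient.liftₐ (RingHom.ker π) q hq).comp
    (Ideal.quotientKerAlgEquivOfSurjective hπ).symm.toAlgHom
  have hu : ∀ e, u (π e) = q e := by
    intro e
    have : (Ideal.quotientKerAlgEquivOfSurjective hπ).symm (π e) =
        Ideal.Quotient.mk (RingHom.ker π) e := by
      rw [AlgEquiv.symm_apply_eq]
      rfl
    change Ideal.Quotient.liftₐ (RingHom.ker π) q hq
      ((Ideal.quotientKerAlgEquivOfSurjective hπ).symm (π e)) = _
    rw [this]
    rfl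
  have huπ : ∀ K : Ideal E, (K.map (π : E →+* B)).map (u : B →+* (E ⧸ J) ⧸ M') =
      (K.map (Ideal.Quotient.mk J)).map (Ideal.Quotient.mk M') := by
    intro K
    rw [Ideal.map_map, Ideal.map_map]
    congr 1
    exact RingHom.ext hu
  have h𝔞 : (𝔞 ^ (n + 1)).map (algebraMap A (E ⧸ J)) = ⊥ := by
    have h1 : 𝔞.map (algebraMap A E) ≤ b.comap (π : E →+* B) := by
      rw [← Ideal.map_le_iff_le_comap, Ideal.map_map]
      convert hab using 2
      exact π.comp_algebraMap
    have h2 : (𝔞 ^ (n + 1)).map (algebraMap A E) ≤ J := by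
      rw [Ideal.map_pow]
      exact (Ideal.pow_right_mono h1 _).trans hbJ
    rw [eq_bot_iff, ← Ideal.map_quotient_self J]
    refine le_trans (le_of_eq ?_) (Ideal.map_mono h2)
    rw [Ideal.map_map]
    rfl
  have hM' : M' ^ 2 = ⊥ := by
    rw [← Ideal.map_pow, hker, Ideal.map_bot]
  have hut : (b ^ (n + 1)).map u = ⊥ := by
    change (b ^ (n + 1)).map (u : B →+* (E ⧸ J) ⧸ M') = ⊥
    rw [← hJb, huπ, Ideal.map_quotient_self, Ideal.map_bot]
  have hbM' : (b.map u).comap (Ideal.Quotient.mk M') * M' = ⊥ := by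
    have h1 : b.map (u : B →+* (E ⧸ J) ⧸ M') =
        ((b.comap (π : E →+* B)).map (Ideal.Quotient.mk J)).map (Ideal.Quotient.mk M') := by
      rw [← huπ, Ideal.map_comap_of_surjective (π : E →+* B) hπ]
    change (b.map (u : B →+* (E ⧸ J) ⧸ M')).comap (Ideal.Quotient.mk M') * M' = ⊥
    rw [h1, Ideal.comap_map_of_surjective _ Ideal.Quotient.mk_surjective, ← RingHom.ker,
      Ideal.mk_ker, sup_eq_left.mpr (Ideal.map_mono (Ideal.ker_le_comap _)), ← Ideal.map_mul]
    exact (congrArg _ hb).trans Ideal.map_bot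
  obtain ⟨g, hg⟩ := h (E ⧸ J) ⟨n, h𝔞⟩ M' hM' u ⟨n, hut⟩ hbM'
  exact AlgHom.exists_section_of_quotient_lift π hπ J hJ g fun e ↦
    Ideal.Quotient.eq.mp ((DFunLike.congr_fun hg (π e)).trans (hu e))

/-- For noetherian `B`, formal smoothness for `b` with the `b`-adic topology implies it for
arbitrary filtrations. -/
theorem IsFormallySmoothFor.of_adic {A : Type u} {B : Type v} [CommRing A] [CommRing B]
    [Algebra A B] [IsNoetherianRing B] {𝔞 : Ideal A} {b : Ideal B}
    (hab : 𝔞.map (algebraMap A B) ≤ b)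
    (h : IsFormallySmoothFor A B (fun n => 𝔞 ^ (n + 1)) b (fun n => b ^ (n + 1)))
    (𝔄 : ℕ → Ideal A) (𝔅 : ℕ → Ideal B) : IsFormallySmoothFor A B 𝔄 b 𝔅 := by
  intro C _ _ _ M _ u _ hb
  let E : Subalgebra A (C × B) := AlgHom.equalizer
    ((Ideal.Quotient.mkₐ A M).comp (AlgHom.fst A C B)) (u.comp (AlgHom.snd A C B))
  let π : E →ₐ[A] B := (AlgHom.snd A C B).comp E.val
  have hE : ∀ e : E, Ideal.Quotient.mk M e.1.1 = u e.1.2 := fun e ↦ e.2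
  have hπ : Function.Surjective π := by
    intro y
    obtain ⟨c, hc⟩ := Ideal.Quotient.mk_surjective (u y)
    exact ⟨⟨(c, y), hc⟩, rfl⟩
  have hkerM : ∀ e ∈ RingHom.ker π, e.1.1 ∈ M := by
    intro e he
    rw [← Ideal.Quotient.eq_zero_iff_mem, hE, (show e.1.2 = 0 from he), map_zero]
  have hb' : b.comap π * RingHom.ker π = ⊥ := by
    rw [eq_bot_iff, Ideal.mul_le]
    intro e he m hm
    have h0 : e.1.1 * m.1.1 ∈ (b.map u).comap (Ideal.Quotient.mk M) * M := by
      refine Ideal.mul_mem_mul ?_ (hkerM m hm)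
      rw [Ideal.mem_comap, hE]
      exact Ideal.mem_map_of_mem u he
    rw [hb, Ideal.mem_bot] at h0
    refine Subtype.ext (Prod.ext h0 ?_)
    change e.1.2 * m.1.2 = 0
    rw [(show m.1.2 = 0 from hm), mul_zero]
  have hker : RingHom.ker π ^ 2 = ⊥ := by
    rw [eq_bot_iff, pow_two]
    exact (Ideal.mul_mono_left (Ideal.ker_le_comap _)).trans hb'.le
  obtain ⟨s, hs⟩ := h.exists_section hab π hπ hker hb'
  refine ⟨((AlgHom.fst A C B).comp E.val).comp s, AlgHom.ext fun y ↦ ?_⟩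
  exact (hE (s y)).trans (congrArg u (DFunLike.congr_fun hs y))

/-- For a **noetherian** `B`, formal smoothness for the ideal `𝔟` does not depend on the
choice of an adic topology given by a smaller ideal `b̃ ⊆ 𝔟`: with the `𝔞`-adic topology
on `A`, `B` is formally smooth for `𝔟` with the `b̃`-adic topology iff it is formally
smooth for `𝔟` with the `𝔟`-adic topology. -/
theorem isFormallySmoothFor_noetherian_adic_independent
    (A : Type u) (B : Type v) [CommRing A] [CommRing B] [Algebra A B] [IsNoetherianRing B]
    (𝔞 : Ideal A) (btilde 𝔟 : Ideal B) (hbb : btilde ≤ 𝔟)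
    (hab : Ideal.map (algebraMap A B) 𝔞 ≤ btilde) :
    IsFormallySmoothFor A B (fun n => 𝔞 ^ (n + 1)) 𝔟 (fun n => btilde ^ (n + 1)) ↔
      IsFormallySmoothFor A B (fun n => 𝔞 ^ (n + 1)) 𝔟 (fun n => 𝔟 ^ (n + 1)) := by
  refine ⟨fun h C _ _ hr M hM u ⟨t, ht⟩ hb ↦ h C hr M hM u ⟨t, ?_⟩ hb,
    fun h ↦ h.of_adic (hab.trans hbb) _ _⟩
  exact eq_bot_iff.mpr ((Ideal.map_mono (Ideal.pow_right_mono hbb _)).trans ht.le)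
end

section
/- Let A be a valuation ring which is not a field and whose maximal ideal 𝔪 satisfies 𝔪 = 𝔪² (for instance, a rank-one non-discrete valuation ring). Let K = A/𝔪 be the residue field. Then: (a) K is a formally smooth A-algebra, i.e. for every commutative A-algebra C, every ideal M of C with M² = 0, and every A-algebra homomorphism u : K → C/M, there exists an A-algebra homomorphism g : K → C with p ∘ g = u, where p : C → C/M is the projection; but (b) K is not flat as an A-module. -/
universe u v

/-- **A formally smooth algebra over a non-noetherian local ring need not be flat.**
Let `A` be a valuation ring which is not a field and whose maximal ideal `𝔪` satisfies
`𝔪 = 𝔪²`, and let `K = A/𝔪` be its residue field.  Then (a) `K` is a formally smooth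
`A`-algebra: every `A`-algebra map `K → C/M` with `M` a square-zero ideal lifts to an
`A`-algebra map `K → C`; but (b) `K` is not flat as an `A`-module. -/
theorem residueField_formallySmooth_not_flat
    (A : Type u) [CommRing A] [IsDomain A] [ValuationRing A]
    (hnf : ¬IsField A)
    (hm : IsLocalRing.maximalIdeal A = IsLocalRing.maximalIdeal A ^ 2) :
    (∀ (C : Type u) [CommRing C] [Algebra A C] (M : Ideal C), M ^ 2 = ⊥ →
      ∀ u : IsLocalRing.ResidueField A →ₐ[A] C ⧸ M,
        ∃ g : IsLocalRing.ResidueField A →ₐ[A] C, (Ideal.Quotient.mkₐ A M).comp g = u) ∧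
    ¬Module.Flat A (IsLocalRing.ResidueField A) := by
  refine ⟨fun C _ _ M hM u => ?_, fun hflat => ?_⟩
  · have hle : (IsLocalRing.maximalIdeal A).map (algebraMap A C) ≤ M := by
      refine Ideal.map_le_iff_le_comap.mpr fun a ha => ?_
      rw [Ideal.mem_comap, ← Ideal.Quotient.eq_zero_iff_mem, ← Ideal.Quotient.algebraMap_eq,
        ← IsScalarTower.algebraMap_apply, ← u.commutes,
        IsLocalRing.ResidueField.algebraMap_eq, (IsLocalRing.residue_eq_zero_iff a).mpr ha,
        map_zero]
    have hzero : (IsLocalRing.maximalIdeal A).map (algebraMap A C) = ⊥ := by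
      rw [hm, Ideal.map_pow, eq_bot_iff, ← hM]
      exact Ideal.pow_right_mono hle 2
    refine ⟨Ideal.Quotient.liftₐ (IsLocalRing.maximalIdeal A) (Algebra.ofId A C) fun a ha => ?_, ?_⟩
    · exact (Submodule.mem_bot C).mp (hzero ▸ Ideal.mem_map_of_mem (algebraMap A C) ha)
    · ext x
      obtain ⟨a, rfl⟩ := IsLocalRing.residue_surjective x
      rw [← IsLocalRing.ResidueField.algebraMap_eq, AlgHom.commutes, AlgHom.commutes]
  · obtain ⟨a, ha, ha0⟩ := Submodule.exists_mem_ne_zero_of_ne_bot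
      fun h => hnf (IsLocalRing.isField_iff_maximalIdeal_eq.mpr h)
    have hreg : IsSMulRegular (IsLocalRing.ResidueField A) a :=
      Module.Flat.isSMulRegular_of_nonZeroDivisors (mem_nonZeroDivisors_of_ne_zero ha0)
    refine one_ne_zero (α := IsLocalRing.ResidueField A) (hreg ?_)
    simp only [Algebra.smul_def, IsLocalRing.ResidueField.algebraMap_eq,
      (IsLocalRing.residue_eq_zero_iff a).mpr ha, zero_mul]
end

section
/- Let p be a prime and let f : A → B be a homomorphism of commutative rings of characteristic p. Let C denote the ring A ⊗_A B in which the left tensor factor A is regarded as an A-algebra via the Frobenius endomorphism a ↦ a^p, and regard B as a C-algebra via the relative Frobenius homomorphism Φ : C → B, Φ(a ⊗ b) = f(a)·b^p. If the module of Kähler differentials Ω_{B/C} is zero, then the module of Kähler differentials Ω_{B/A} is zero. -/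
open TensorProduct

universe u

/-- `Frob p A` is the ring `A`, regarded as an `A`-algebra via the Frobenius `a ↦ a ^ p`. -/
def Frob (p : ℕ) (A : Type u) : Type u := A

instance Frob.instCommRing (p : ℕ) (A : Type u) [CommRing A] : CommRing (Frob p A) :=
  ‹CommRing A›

noncomputable instance Frob.instAlgebra (p : ℕ) (A : Type u) [CommRing A] [Fact p.Prime]
    [CharP A p] : Algebra A (Frob p A) :=
  RingHom.toAlgebra (frobenius A p)

/-- The identity map of `A`, viewed as landing in `Frob p A`. -/
def toFrob (p : ℕ) {A : Type u} (a : A) : Frob p A := a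

/-- A derivation over any base that kills the image of `C` in `S` vanishes if `Ω[S⁄C] = 0`. -/
theorem Derivation.eq_zero_of_subsingleton_kaehlerDifferential {R C S M : Type*} [CommRing R]
    [CommRing C] [CommRing S] [Algebra R S] [Algebra C S] [AddCommGroup M] [Module R M]
    [Module S M] [Subsingleton (Ω[S⁄C])] (d : Derivation R S M)
    (hd : ∀ c : C, d (algebraMap C S c) = 0) : d = 0 := by
  let _ : Module C M := Module.compHom M (algebraMap C S)
  have : IsScalarTower C S M := IsScalarTower.of_algebraMap_smul fun _ _ => rfl
  let d' : Derivation C S M := Derivation.mk'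
    { toFun := d
      map_add' := map_add d
      map_smul' := fun c s => by
        rw [Algebra.smul_def, d.leibniz, hd, smul_zero, add_zero, algebraMap_smul]
        rfl } d.leibniz
  ext s
  have hs : d'.liftKaehlerDifferential (KaehlerDifferential.D C S s) = d' s :=
    d'.liftKaehlerDifferential_comp_D s
  rw [Subsingleton.elim (KaehlerDifferential.D C S s) 0, map_zero] at hs
  exact hs.symm

/-- In characteristic `p`, derivations kill `p`-th powers. -/
theorem Derivation.map_pow_char {R S M : Type*} [CommRing R] [CommRing S] [Algebra R S]
    [AddCommGroup M] [Module R M] [Module S M] (p : ℕ) [CharP S p] (d : Derivation R S M)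
    (s : S) : d (s ^ p) = 0 := by
  rw [d.leibniz_pow, ← Nat.cast_smul_eq_nsmul S, CharP.cast_eq_zero, zero_smul]

theorem KaehlerDifferential.subsingleton_of_D_eq_zero {R S : Type*} [CommRing R] [CommRing S]
    [Algebra R S] (h : KaehlerDifferential.D R S = 0) : Subsingleton (Ω[S⁄R]) := by
  rw [← Submodule.subsingleton_iff S, ← subsingleton_iff_bot_eq_top, eq_comm,
    ← KaehlerDifferential.span_range_derivation, Submodule.span_eq_bot]
  rintro _ ⟨s, rfl⟩
  rw [h, Derivation.zero_apply]

/-- Let `p` be a prime, `f : A → B` a homomorphism of commutative rings of characteristic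
`p`, `C = (^φA) ⊗_A B` the base change of `B` along the Frobenius of `A`, and
`Φ : C → B`, `Φ(a ⊗ b) = f a * b ^ p`, the relative Frobenius, making `B` a `C`-algebra.
If `Ω_{B/C} = 0` then `Ω_{B/A} = 0`. -/
theorem kaehlerDifferential_eq_zero_of_relativeFrobenius
    (p : ℕ) [Fact p.Prime] (A B : Type u) [CommRing A] [CommRing B]
    [CharP A p] [CharP B p] [Algebra A B]
    (Φ : (Frob p A ⊗[A] B) →+* B)
    (hΦ : ∀ (a : A) (b : B), Φ (toFrob p a ⊗ₜ[A] b) = algebraMap A B a * b ^ p)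
    (h : letI : Algebra (Frob p A ⊗[A] B) B := Φ.toAlgebra
      Subsingleton (Ω[B⁄Frob p A ⊗[A] B])) :
    Subsingleton (Ω[B⁄A]) := by
  let _ : Algebra (Frob p A ⊗[A] B) B := Φ.toAlgebra
  have : Subsingleton (Ω[B⁄Frob p A ⊗[A] B]) := h
  have hD (a : A) (b : B) : KaehlerDifferential.D A B (Φ (toFrob p a ⊗ₜ[A] b)) = 0 := by
    rw [hΦ, Derivation.leibniz, Derivation.map_pow_char p, Derivation.map_algebraMap,
      smul_zero, smul_zero, add_zero]
  refine KaehlerDifferential.subsingleton_of_D_eq_zero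
    (Derivation.eq_zero_of_subsingleton_kaehlerDifferential (C := Frob p A ⊗[A] B) _ fun c => ?_)
  change KaehlerDifferential.D A B (Φ c) = 0
  induction c using TensorProduct.induction_on with
  | zero => rw [map_zero, map_zero]
  | add x y hx hy => rw [map_add, map_add, hx, hy, add_zero]
  | tmul a b => exact hD a b
end

section
/- Let A be a commutative ring, 𝔞 an ideal of A, and f : M → N a homomorphism of A-modules such that the induced map M/𝔞M → N/𝔞N is surjective. Then the induced homomorphism on 𝔞-adic completions f̂ : M̂ → N̂, where M̂ = lim_n M/𝔞ⁿM and N̂ = lim_n N/𝔞ⁿN, is surjective. -/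
universe u v w

/-- If `f : M → N` is a homomorphism of modules over a commutative ring `A` and `𝔞` is an
ideal of `A` such that the induced map `M/𝔞M → N/𝔞N` is surjective, then the induced map
`f̂ : M̂ → N̂` on `𝔞`-adic completions is surjective.  (No noetherian or finiteness
hypotheses.) -/
theorem adicCompletion_map_surjective_of_surjective_mod
    (A : Type u) [CommRing A] (𝔞 : Ideal A)
    (M : Type v) (N : Type v) [AddCommGroup M] [Module A M] [AddCommGroup N] [Module A N]
    (f : M →ₗ[A] N)
    (hsurj : ∀ y : N, ∃ x : M, y - f x ∈ (𝔞 • ⊤ : Submodule A N)) :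
    Function.Surjective (AdicCompletion.map 𝔞 f) := by
  refine AdicCompletion.map_surjective_of_mkQ_comp_surjective fun z => ?_
  obtain ⟨y, rfl⟩ := Submodule.mkQ_surjective _ z
  obtain ⟨x, hx⟩ := hsurj y
  exact ⟨x, ((Submodule.Quotient.eq _).mpr hx).symm⟩
end

section
/- Let A be a commutative ring, 𝔞 an ideal of A, N an A-module and P ⊆ N a submodule such that N = P + 𝔞N. Then for every n ≥ 1 one has P ∩ 𝔞ⁿN ⊆ 𝔞ⁿP + (P ∩ 𝔞ⁿ⁺¹N). -/
universe u v

/-- **The Mittag-Leffler inclusion.** Let `A` be a commutative ring, `𝔞` an ideal of `A`,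
`N` an `A`-module and `P ⊆ N` a submodule with `N = P + 𝔞N`.  Then for every `n ≥ 1`,
`P ∩ 𝔞ⁿN ⊆ 𝔞ⁿP + (P ∩ 𝔞ⁿ⁺¹N)`. -/
theorem inf_smul_le_smul_sup_inf_smul
    (A : Type u) [CommRing A] (𝔞 : Ideal A)
    (N : Type v) [AddCommGroup N] [Module A N] (P : Submodule A N)
    (h : P ⊔ (𝔞 • ⊤ : Submodule A N) = ⊤) :
    ∀ n : ℕ, 1 ≤ n →
      P ⊓ (𝔞 ^ n • ⊤ : Submodule A N) ≤
        𝔞 ^ n • P ⊔ (P ⊓ (𝔞 ^ (n + 1) • ⊤ : Submodule A N)) := by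
  intro n _
  have hn : (𝔞 ^ n • ⊤ : Submodule A N) = 𝔞 ^ n • P ⊔ 𝔞 ^ (n + 1) • ⊤ := by
    rw [pow_succ, Submodule.mul_smul, ← Submodule.smul_sup, h]
  rw [hn, inf_comm, sup_inf_assoc_of_le _ (Submodule.smul_le_right : 𝔞 ^ n • P ≤ P), inf_comm]
end

section
/- Let A be a commutative ring, n an integer, and C_* a chain complex of A-modules. If for every A-module M the cochain complex Hom_A(C_*, M) has vanishing cohomology in degree n, then for every A-module M the chain complex C_* ⊗_A M has vanishing homology in degree n. -/
universe u v

/-- Let `A` be a commutative ring, `n` an integer (written here as `m + 1`, with `m : ℤ`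
arbitrary, so that the complex is indexed without casts), and `C_*` a chain complex of
`A`-modules, with differentials `d n : C (n+1) → C n` satisfying `d ∘ d = 0`.  If for every
`A`-module `M` the complex `Hom_A(C_*, M)` has vanishing cohomology in degree `n`, then for
every `A`-module `M` the complex `C_* ⊗_A M` has vanishing homology in degree `n`. -/
theorem tensor_homology_vanishes_of_hom_cohomology_vanishes
    (A : Type u) [CommRing A]
    (C : ℤ → Type v) [∀ n, AddCommGroup (C n)] [∀ n, Module A (C n)]
    (d : ∀ n : ℤ, C (n + 1) →ₗ[A] C n)
    (hd : ∀ n : ℤ, (d n).comp (d (n + 1)) = 0)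
    (m : ℤ)
    (hcoh : ∀ (M : Type (max u v)) [AddCommGroup M] [Module A M],
      ∀ φ : C (m + 1) →ₗ[A] M, φ.comp (d (m + 1)) = 0 →
        ∃ ψ : C m →ₗ[A] M, ψ.comp (d m) = φ) :
    ∀ (M : Type (max u v)) [AddCommGroup M] [Module A M],
      ∀ x : TensorProduct A (C (m + 1)) M, LinearMap.rTensor M (d m) x = 0 →
        ∃ y : TensorProduct A (C (m + 1 + 1)) M, LinearMap.rTensor M (d (m + 1)) y = x := by
  intro M _ _ x hx
  let q := (LinearMap.range (d (m + 1))).mkQ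
  have hq : Function.Exact (d (m + 1)) q := LinearMap.exact_map_mkQ_range _
  let e : ULift.{u} (C (m + 1) ⧸ LinearMap.range (d (m + 1))) ≃ₗ[A] _ := ULift.moduleEquiv
  obtain ⟨ψ, hψ⟩ := hcoh _ (e.symm.toLinearMap ∘ₗ q) (by
    rw [LinearMap.comp_assoc, hq.linearMap_comp_eq_zero, LinearMap.comp_zero])
  have hfactor : (e.toLinearMap ∘ₗ ψ) ∘ₗ d m = q := by
    rw [LinearMap.comp_assoc, hψ]
    ext c
    simp
  refine (rTensor_exact M hq (Submodule.mkQ_surjective _) x).mp ?_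
  rw [← hfactor, LinearMap.rTensor_comp_apply, hx, map_zero]
end

section
/- Let R be a commutative integral domain and let M be a projective R-module. Then the symmetric algebra Sym_R(M) is an integral domain. -/
universe u

/-- **The symmetric algebra of a projective module over a domain is a domain.**
Let `R` be a commutative integral domain and `M` a projective `R`-module.  If `S` is a
commutative `R`-algebra equipped with an `R`-linear map `ι : M → S` satisfying the
universal property of the symmetric algebra `Sym_R(M)` (every `R`-linear map from `M` to a
commutative `R`-algebra `T` extends uniquely to an `R`-algebra homomorphism `S → T`),
then `S` is an integral domain. -/
theorem symmetricAlgebra_isDomain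
    (R : Type u) [CommRing R] [IsDomain R]
    (M : Type u) [AddCommGroup M] [Module R M] [Module.Projective R M]
    (S : Type u) [CommRing S] [Algebra R S] (ι : M →ₗ[R] S)
    (hUP : ∀ (T : Type u) [CommRing T] [Algebra R T] (f : M →ₗ[R] T),
      ∃! g : S →ₐ[R] T, g.toLinearMap.comp ι = f) :
    IsDomain S := by
  obtain ⟨s, hs⟩ := Module.projective_def'.mp ‹Module.Projective R M›
  obtain ⟨g, hg, -⟩ := hUP (MvPolynomial M R)
    ((Finsupp.linearCombination R (MvPolynomial.X (R := R))).comp s)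
  let h : MvPolynomial M R →ₐ[R] S := MvPolynomial.aeval ι
  have hX : h.toLinearMap.comp (Finsupp.linearCombination R (MvPolynomial.X (R := R))) =
      ι.comp (Finsupp.linearCombination R id) := by
    ext m
    simp [h]
  have hcomp : h.comp g = AlgHom.id R S := by
    refine (hUP S ι).unique ?_ (by ext; simp)
    rw [AlgHom.comp_toLinearMap, LinearMap.comp_assoc, hg, ← LinearMap.comp_assoc, hX,
      LinearMap.comp_assoc, hs, LinearMap.comp_id]
  have hinj : Function.Injective g :=
    Function.LeftInverse.injective (g := h) fun x => congr($hcomp x)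
  exact hinj.isDomain g.toRingHom
end
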